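/- Let n, k be nonnegative integers with n ≥ 2k. Then, as an identity of polynomials in q, ∑_{w ∈ Π_{n,k}} q^{maj(w⁻¹)} = ∑_{r=0}^{k} (−1)^{k−r} · C(k,r) · [n]_q · [n−1]_q ⋯ [n−r+1]_q (the product on the right having r factors, and being the empty product 1 when r = 0). -/

import Mathlib

open Polynomial

/-- `w` has an increasing subsequence of length `m`. -/
def HasIncSubseq {n : ℕ} (w : Equiv.Perm (Fin n)) (m : ℕ) : Prop :=
  ∃ f : Fin m → Fin n, StrictMono f ∧ StrictMono fun j => w (f j)

/-- The length of the longest increasing subsequence of `w`. -/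
noncomputable def isLen {n : ℕ} (w : Equiv.Perm (Fin n)) : ℕ :=
  sSup {m | HasIncSubseq w m}

/-- The first `n - s` values of `w` are increasing (positions `0,…,n-s-1` in 0-indexing,
i.e. `w(1) < ⋯ < w(n-s)` in 1-indexing). -/
def PrefixInc (n s : ℕ) (w : Equiv.Perm (Fin n)) : Prop :=
  ∀ i j : Fin n, (i : ℕ) < j → (j : ℕ) < n - s → w i < w j

/-- Major index of a permutation: the sum of the (1-indexed) descent positions.
Position `i ∈ {0,…,n-2}` (0-indexed) contributes `i + 1`. -/
def maj {n : ℕ} (σ : Equiv.Perm (Fin n)) : ℕ :=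
  ∑ i ∈ Finset.range n,
    if h : i + 1 < n then
      if σ ⟨i + 1, h⟩ < σ ⟨i, Nat.lt_of_succ_lt h⟩ then i + 1 else 0
    else 0

/-- The q-integer `[m]_q = 1 + q + ⋯ + q^{m-1}` as a polynomial in `q = X` over `ℤ`. -/
noncomputable def qInt (m : ℕ) : Polynomial ℤ :=
  ∑ i ∈ Finset.range m, (X : Polynomial ℤ) ^ i

/-- The set `Π_{n,k}` of permutations whose first `n - k` values are increasing and whose
longest increasing subsequence has length exactly `n - k`, as a `Finset`. -/
noncomputable def PiFinset (n k : ℕ) : Finset (Equiv.Perm (Fin n)) :=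
  @Finset.filter _ (fun w => PrefixInc n k w ∧ isLen w = n - k) (Classical.decPred _)
    Finset.univ

/-- The set `C_{n,s}` of permutations whose first `n - s` values are increasing,
as a `Finset`. -/
noncomputable def CFinset (n s : ℕ) : Finset (Equiv.Perm (Fin n)) :=
  @Finset.filter _ (fun w => PrefixInc n s w) (Classical.decPred _) Finset.univ

/-- The prefix `w(1),…,w(a)` (1-indexed) contains an increasing subsequence of length `m`. -/
def HasIncSubseqPrefix {n : ℕ} (w : Equiv.Perm (Fin n)) (a m : ℕ) : Prop :=
  ∃ f : Fin m → Fin n, StrictMono f ∧ (∀ j, (f j : ℕ) < a) ∧ StrictMono fun j => w (f j)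

/-- Membership in `C_{n,s,a}`: `π ∈ C_{n,s}`, the prefix of length `a` contains an increasing
subsequence of length `n - s + 1`, but the prefix of length `a - 1` does not. -/
def MemCa (n s a : ℕ) (π : Equiv.Perm (Fin n)) : Prop :=
  PrefixInc n s π ∧ HasIncSubseqPrefix π a (n - s + 1) ∧
    ¬ HasIncSubseqPrefix π (a - 1) (n - s + 1)

/-- The set `C_{n,s,a}` as a `Finset`. -/
noncomputable def CaFinset (n s a : ℕ) : Finset (Equiv.Perm (Fin n)) :=
  @Finset.filter _ (fun π => MemCa n s a π) (Classical.decPred _) Finset.univ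

/-- `RowInsertable y R` says that the letters of `y`, taken from the last one to the first, can be
reverse row inserted into the strictly increasing row `R`, each one bumping out an entry. -/
inductive RowInsertable : List ℕ → List ℕ → Prop
  | nil {R : List ℕ} : R.Pairwise (· < ·) → RowInsertable [] R
  | snoc {y A B : List ℕ} {x z : ℕ} : RowInsertable y (A ++ z :: B) →
      (A ++ x :: z :: B).Pairwise (· < ·) → RowInsertable (y ++ [z]) (A ++ x :: B)

namespace RowInsertable

lemma pairwise {y R : List ℕ} (h : RowInsertable y R) : R.Pairwise (· < ·) := by
  cases h with
  | nil h => exact h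
  | snoc _ h => exact h.sublist (by simp)

lemma exists_of_snoc {y R : List ℕ} {z : ℕ} (h : RowInsertable (y ++ [z]) R) :
    ∃ A x B, R = A ++ x :: B ∧ RowInsertable y (A ++ z :: B) ∧
      (A ++ x :: z :: B).Pairwise (· < ·) := by
  generalize hw : y ++ [z] = w at h
  cases h with
  | nil => simp at hw
  | snoc h₁ h₂ =>
    obtain ⟨rfl, hz⟩ := List.append_inj' hw rfl
    obtain rfl : z = _ := by simpa using hz
    exact ⟨_, _, _, rfl, h₁, h₂⟩

/-- An entry with at least `y.length` smaller entries can be deleted from the row. -/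
lemma erase {y R : List ℕ} (h : RowInsertable y R) :
    ∀ {S T : List ℕ} {e : ℕ}, R = S ++ e :: T → y.length ≤ S.length →
      RowInsertable y (S ++ T) := by
  induction h with
  | nil h => rintro S T e rfl -; exact .nil (h.sublist (by simp))
  | @snoc y A B x z h hp ih =>
    intro S T e hR hlen
    rcases List.append_eq_append_iff.1 hR with ⟨C, rfl, hC⟩ | ⟨C, rfl, hC⟩
    · cases C with
      | nil =>
        obtain ⟨rfl, rfl⟩ : x = e ∧ B = T := by simpa using hC
        obtain rfl | ⟨S, p, rfl⟩ := A.eq_nil_or_concat'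
        · simp at hlen
        · have h1 := ih (S := S) (e := p) (T := z :: B) (by simp) (by simpa using hlen)
          have := h1.snoc (x := p) (hp.sublist (by simp))
          simpa using this
      | cons c C =>
        obtain ⟨rfl, rfl⟩ : x = c ∧ B = C ++ e :: T := by simpa using hC
        have h1 := ih (S := A ++ z :: C) (e := e) (T := T) (by simp)
          (by simp at hlen ⊢; omega)
        have := snoc (A := A) (B := C ++ T) (x := x) (z := z) (by simpa using h1)
          (hp.sublist (by simp))
        simpa using this
    · cases C with
      | nil =>
        obtain ⟨rfl, rfl⟩ : e = x ∧ T = B := by simpa using hC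
        simp only [List.append_nil] at *
        obtain rfl | ⟨S, p, rfl⟩ := S.eq_nil_or_concat'
        · simp at hlen
        · have h1 := ih (S := S) (e := p) (T := z :: T) (by simp) (by simpa using hlen)
          have := h1.snoc (x := p) (hp.sublist (by simp))
          simpa using this
      | cons c C =>
        obtain ⟨rfl, rfl⟩ : e = c ∧ T = C ++ x :: B := by simpa using hC
        have h1 := ih (S := S) (e := e) (T := C ++ z :: B) (by simp) (by simp at hlen ⊢; omega)
        have := snoc (A := S ++ C) (B := B) (x := x) (z := z) (by simpa using h1)
          (hp.sublist (by simp))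
        simpa using this

/-- A new entry, not a letter of `y`, can be added to the row. -/
lemma insert {y R : List ℕ} (h : RowInsertable y R) :
    ∀ {S T : List ℕ} {e : ℕ}, R = S ++ T → (S ++ e :: T).Pairwise (· < ·) →
      (∀ a ∈ y, a ∉ S ++ e :: T) → y.Nodup → RowInsertable y (S ++ e :: T) := by
  induction h with
  | nil h => intro S T e _ hp _ _; exact .nil hp
  | @snoc y A B x z h hp ih =>
    intro S T e hR hS hd hn
    obtain ⟨hny, hzy⟩ : y.Nodup ∧ z ∉ y := by
      rw [List.nodup_append] at hn
      exact ⟨hn.1, fun hz => hn.2.2 z hz z (by simp) rfl⟩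
    have hez : e ≠ z := by
      rintro rfl
      exact hd e (by simp) (by simp)
    have key : ∀ C, A = S ++ C → T = C ++ x :: B →
        RowInsertable (y ++ [z]) (S ++ e :: T) := by
      rintro C rfl rfl
      have hq : (S ++ e :: (C ++ x :: z :: B)).Pairwise (· < ·) := by
        clear ih hd hR
        simp only [List.pairwise_append, List.pairwise_cons, List.mem_append,
          List.mem_cons] at hp hS ⊢
        have hex : e < x := hS.2.1.1 x (by simp)
        have hxz : x < z := hp.2.1.1 z (by simp)
        refine ⟨hS.1, ⟨?_, hS.2.1.2.1, hp.2.1, fun a ha => hp.2.2 a (.inr ha)⟩, ?_⟩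
        · rintro a (ha | rfl | rfl | ha)
          exacts [hS.2.1.1 a (.inl ha), hex, hex.trans hxz, hS.2.1.1 a (.inr (.inr ha))]
        · rintro a ha b (rfl | hb | hb)
          exacts [hS.2.2 a ha b (.inl rfl), hS.2.2 a ha b (.inr (.inl hb)),
            hp.2.2 a (.inl ha) b hb]
      have h1 := ih (S := S) (T := C ++ z :: B) (e := e) (by simp)
        (hq.sublist (by simp)) (by simp at hd ⊢; grind) hny
      have := snoc (A := S ++ e :: C) (B := B) (x := x) (z := z) (by simpa using h1)
        (by simpa using hq)
      simpa using this
    rcases List.append_eq_append_iff.1 hR with ⟨C, rfl, hC⟩ | ⟨C, hA, hC⟩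
    · cases C with
      | nil => exact key [] (by simp) (by simpa using hC.symm)
      | cons c C =>
        obtain ⟨rfl, rfl⟩ : x = c ∧ B = C ++ T := by simpa using hC
        clear key hC hR
        have hS' := hS
        have hp' := hp
        simp only [List.pairwise_append, List.pairwise_cons, List.mem_append,
          List.mem_cons] at hp' hS'
        have hxz : x < z := hp'.2.1.1 z (by simp)
        have hxe : x < e := hS'.2.2 x (by simp) e (by simp)
        by_cases hze : z < e
        · have hq : (A ++ x :: z :: (C ++ e :: T)).Pairwise (· < ·) := by
            simp only [List.pairwise_append, List.pairwise_cons, List.mem_append,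
              List.mem_cons]
            clear ih hd hn
            grind
          have h1 := ih (S := A ++ z :: C) (T := T) (e := e) (by simp)
            (by simpa using hq.sublist (l₁ := A ++ z :: (C ++ e :: T)) (by simp))
            (by simp at hd ⊢; grind) hny
          have := snoc (A := A) (B := C ++ e :: T) (x := x) (z := z) (by simpa using h1) hq
          simpa using this
        · have hez' : e < z := by omega
          obtain rfl : C = [] := by
            rcases C with _ | ⟨c, C⟩
            · rfl
            · have h₁ := hp'.2.1.2.1 c (by simp)
              have h₂ := hS'.2.2 c (by simp) e (by simp)
              omega
          have hq : (A ++ x :: e :: z :: T).Pairwise (· < ·) := by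
            simp only [List.pairwise_append, List.pairwise_cons, List.mem_cons]
            refine ⟨hp'.1, ⟨?_, ⟨?_, fun a ha => hp'.2.1.2.1 a (.inr ha), hS'.2.1.2⟩⟩, ?_⟩
            · rintro a (rfl | rfl | ha)
              exacts [hxe, hxz, hp'.2.1.1 a (by simp [ha])]
            · rintro a (rfl | ha)
              exacts [hez', hS'.2.1.1 a ha]
            · rintro a ha b (rfl | rfl | hb)
              exacts [hp'.2.2 a ha b (by simp), hS'.2.2 a (by simp [ha]) b (by simp),
                hp'.2.2 a ha b (by simp [hb])]
          have h1 := ih (S := A) (T := z :: T) (e := x) (by simp)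
            (hq.sublist (by simp)) (by simp at hd ⊢; grind) hny
          have := snoc (A := A ++ [x]) (B := T) (x := e) (z := z) (by simpa using h1)
            (by simpa using hq)
          simpa using this
    · exact key C hA hC

end RowInsertable

/-- The words which are permutations of `0, …, n - 1`. -/
def permWords (n : ℕ) : Finset (List ℕ) := (List.range n).permutations.toFinset

lemma mem_permWords {n : ℕ} {l : List ℕ} : l ∈ permWords n ↔ l.Perm (List.range n) := by
  simp [permWords]

/-- The major index of the inverse of a word in `permWords n`. -/
def invMaj (n : ℕ) (l : List ℕ) : ℕ :=
  ∑ i ∈ Finset.range (n - 1), if l.idxOf (i + 1) < l.idxOf i then i + 1 else 0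

lemma invMaj_swap (n : ℕ) (u v : List ℕ) {a b : ℕ} (h : a + 1 < b ∨ b + 1 < a) :
    invMaj n (u ++ a :: b :: v) = invMaj n (u ++ b :: a :: v) := by
  unfold invMaj
  refine Finset.sum_congr rfl fun i _ => ?_
  have key : (u ++ a :: b :: v).idxOf (i + 1) < (u ++ a :: b :: v).idxOf i ↔
      (u ++ b :: a :: v).idxOf (i + 1) < (u ++ b :: a :: v).idxOf i := by
    have h₁ : i ∈ u → u.idxOf i < u.length := List.idxOf_lt_length_of_mem
    have h₂ : i + 1 ∈ u → u.idxOf (i + 1) < u.length := List.idxOf_lt_length_of_mem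
    simp only [List.idxOf_append, List.idxOf_cons, Bool.cond_eq_ite, beq_iff_eq]
    split_ifs <;> (try have := h₁ ‹_›) <;> (try have := h₂ ‹_›) <;> omega
  simp only [key]

lemma invMaj_move (n : ℕ) (v : List ℕ) {x : ℕ} {B : List ℕ} :
    ∀ u : List ℕ, (∀ b ∈ B, b + 1 < x ∨ x + 1 < b) →
      invMaj n (u ++ B ++ x :: v) = invMaj n (u ++ x :: B ++ v) := by
  induction B with
  | nil => simp
  | cons b B ih =>
    intro u h
    have h1 := ih (u ++ [b]) fun c hc => h c (by simp [hc])
    have h2 := invMaj_swap n u (B ++ v) (h b (by simp))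
    simp only [List.append_assoc, List.cons_append, List.nil_append] at h1 h2 ⊢
    rw [h1, h2]

/-- `Bump t m l l'` says that the word `l` consists of `t` letters, a strictly increasing row of
length `m`, a letter which bumps an entry of the row and further letters, and that `l'` is obtained
by performing this bump, the bumped entry being moved in front of the row. -/
def Bump (t m : ℕ) (l l' : List ℕ) : Prop :=
  ∃ y A z B x rest, y.length = t ∧ A.length + B.length + 1 = m ∧
    (A ++ x :: z :: B).Pairwise (· < ·) ∧
    l = y ++ (A ++ z :: B) ++ x :: rest ∧ l' = y ++ [z] ++ (A ++ x :: B) ++ rest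

namespace Bump

variable {t m : ℕ} {l l' : List ℕ}

lemma perm (h : Bump t m l l') : l.Perm l' := by
  obtain ⟨y, A, z, B, x, rest, -, -, -, rfl, rfl⟩ := h
  rw [List.perm_iff_count]
  intro a
  simp only [List.count_append, List.count_cons, List.count_nil]
  omega

lemma invMaj_eq (n : ℕ) (h : Bump t m l l') : invMaj n l = invMaj n l' := by
  obtain ⟨y, A, z, B, x, rest, -, -, hp, rfl, rfl⟩ := h
  simp only [List.pairwise_append, List.pairwise_cons, List.mem_cons] at hp
  have hxz : x < z := hp.2.1.1 z (by simp)
  have h1 := invMaj_move n rest (x := x) (B := B) (y ++ A ++ [z]) fun b hb => by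
    have := hp.2.1.2.1 b hb
    omega
  have h2 := invMaj_move n (x :: B ++ rest) (x := z) (B := A) y fun a ha => by
    have := hp.2.2 a ha x (by simp)
    omega
  simp only [List.append_assoc, List.cons_append, List.nil_append] at h1 h2 ⊢
  rw [h1, h2]

lemma filter_lt {A B : List ℕ} {x z : ℕ} (h : (A ++ x :: z :: B).Pairwise (· < ·)) :
    (A ++ z :: B).filter (· < x) = A ∧ (A ++ x :: B).filter (· < z) = A ++ [x] := by
  simp only [List.pairwise_append, List.pairwise_cons, List.mem_cons] at h
  have hxz : x < z := h.2.1.1 z (by simp)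
  have hA : ∀ c, x ≤ c → A.filter (· < c) = A := fun c hc =>
    List.filter_eq_self.2 fun a ha => by
      have := h.2.2 a ha x (by simp)
      simp; omega
  have hB : ∀ c, c ≤ z → B.filter (· < c) = [] := fun c hc =>
    List.filter_eq_nil_iff.2 fun b hb => by
      have := h.2.1.2.1 b hb
      simp; omega
  constructor
  · rw [List.filter_append, hA _ le_rfl, List.filter_cons_of_neg (by simp; omega), hB _ hxz.le,
      List.append_nil]
  · rw [List.filter_append, hA _ hxz.le, List.filter_cons_of_pos (by simpa), hB _ le_rfl]

lemma right_unique {l₁ l₂ : List ℕ} (h₁ : Bump t m l l₁) (h₂ : Bump t m l l₂) : l₁ = l₂ := by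
  obtain ⟨y, A, z, B, x, rest, hy, hm, hp, rfl, rfl⟩ := h₁
  obtain ⟨y', A', z', B', x', rest', hy', hm', hp', hl, rfl⟩ := h₂
  obtain ⟨hl, hr⟩ := List.append_inj hl (by simp; omega)
  obtain ⟨rfl, hR⟩ := List.append_inj hl (by omega)
  obtain ⟨rfl, rfl⟩ : x = x' ∧ rest = rest' := by simpa using hr
  obtain rfl : A = A' := by rw [← (filter_lt hp).1, hR, (filter_lt hp').1]
  obtain ⟨rfl, rfl⟩ : z = z' ∧ B = B' := by simpa using hR
  rfl

lemma left_unique {l₁ l₂ : List ℕ} (h₁ : Bump t m l₁ l) (h₂ : Bump t m l₂ l) : l₁ = l₂ := by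
  obtain ⟨y, A, z, B, x, rest, hy, hm, hp, rfl, rfl⟩ := h₁
  obtain ⟨y', A', z', B', x', rest', hy', hm', hp', rfl, hl⟩ := h₂
  obtain ⟨hyR, rfl⟩ := List.append_inj hl (by simp; omega)
  obtain ⟨hyz, hR⟩ := List.append_inj hyR (by simp; omega)
  obtain ⟨rfl, hz⟩ := List.append_inj hyz (by omega)
  obtain rfl : z = z' := by simpa using hz
  have hA : A ++ [x] = A' ++ [x'] := by rw [← (filter_lt hp).2, hR, (filter_lt hp').2]
  obtain ⟨rfl, hx⟩ := List.append_inj' hA rfl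
  obtain ⟨rfl, rfl⟩ : x = x' ∧ B = B' := by simpa using hR
  rfl

end Bump

/-- The generating function of `invMaj` over the words in `permWords n` satisfying `P`. -/
noncomputable def invMajGF (n : ℕ) (P : List ℕ → Prop) : Polynomial ℤ := by
  classical exact ∑ l ∈ permWords n with P l, X ^ invMaj n l

lemma invMajGF_eq_sum_filter (n : ℕ) (P : List ℕ → Prop) [DecidablePred P] :
    invMajGF n P = ∑ l ∈ (permWords n).filter P, X ^ invMaj n l := by
  unfold invMajGF
  congr!

lemma invMajGF_congr {n : ℕ} {P Q : List ℕ → Prop}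
    (h : ∀ l, l.Perm (List.range n) → (P l ↔ Q l)) : invMajGF n P = invMajGF n Q := by
  classical
  unfold invMajGF
  congr 1
  exact Finset.filter_congr fun l hl => h l (mem_permWords.1 hl)

lemma invMajGF_add {n : ℕ} {P Q R : List ℕ → Prop}
    (h : ∀ l, l.Perm (List.range n) → (P l ↔ Q l ∨ R l))
    (hd : ∀ l, l.Perm (List.range n) → Q l → ¬ R l) :
    invMajGF n P = invMajGF n Q + invMajGF n R := by
  classical
  unfold invMajGF
  rw [← Finset.sum_union, ← Finset.filter_or]
  · congr 1
    exact Finset.filter_congr fun l hl => h l (mem_permWords.1 hl)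
  · exact Finset.disjoint_filter.2 fun l hl => hd l (mem_permWords.1 hl)

lemma invMajGF_eq_of_bump {n t m : ℕ} {P Q : List ℕ → Prop}
    (hP : ∀ l, l.Perm (List.range n) → P l → ∃ l', Bump t m l l' ∧ Q l')
    (hQ : ∀ l', l'.Perm (List.range n) → Q l' → ∃ l, Bump t m l l' ∧ P l) :
    invMajGF n P = invMajGF n Q := by
  classical
  unfold invMajGF
  have hP' : ∀ l ∈ (permWords n).filter P, ∃ l', Bump t m l l' ∧ Q l' := fun l hl => by
    rw [Finset.mem_filter, mem_permWords] at hl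
    exact hP l hl.1 hl.2
  choose f hf hfQ using hP'
  refine Finset.sum_bij f (fun l hl => ?_) (fun l₁ h₁ l₂ h₂ h => ?_) (fun l' hl' => ?_)
    fun l hl => ?_
  · rw [Finset.mem_filter, mem_permWords] at hl ⊢
    exact ⟨(hf l _).perm.symm.trans hl.1, hfQ l _⟩
  · exact (hf l₁ h₁).left_unique (h ▸ hf l₂ h₂)
  · rw [Finset.mem_filter, mem_permWords] at hl'
    obtain ⟨l, hl, hPl⟩ := hQ l' hl'.1 hl'.2
    have hmem : l ∈ (permWords n).filter P := by
      rw [Finset.mem_filter, mem_permWords]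
      exact ⟨hl.perm.trans hl'.1, hPl⟩
    exact ⟨l, hmem, (hf l hmem).right_unique hl⟩
  · rw [(hf l hl).invMaj_eq]

/-- The word `l` consists of `t` letters, a row of length `m` into which they can be reverse row
inserted, and further letters. -/
def HasInsertableRow (t m : ℕ) (l : List ℕ) : Prop :=
  ∃ y R rest, l = y ++ R ++ rest ∧ y.length = t ∧ R.length = m ∧ RowInsertable y R

/-- `HasInsertableRow t m l`, where moreover no increasing subsequence of the row and the letters
following it is longer than the row. -/
def HasLongestRow (t m : ℕ) (l : List ℕ) : Prop :=
  ∃ y R rest, l = y ++ R ++ rest ∧ y.length = t ∧ R.length = m ∧ RowInsertable y R ∧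
    ∀ s : List ℕ, s.Sublist (R ++ rest) → s.Pairwise (· < ·) → s.length ≤ m

lemma pairwise_concat_or_exists_bump {x : ℕ} {R : List ℕ} (hR : R.Pairwise (· < ·)) (hx : x ∉ R) :
    (R ++ [x]).Pairwise (· < ·) ∨
      ∃ A z B, R = A ++ z :: B ∧ (A ++ x :: z :: B).Pairwise (· < ·) := by
  induction R with
  | nil => simp
  | cons r R ih =>
    obtain ⟨hxr, hxR⟩ : x ≠ r ∧ x ∉ R := by simpa using hx
    rw [List.pairwise_cons] at hR
    rcases lt_or_gt_of_ne hxr with h | h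
    · refine .inr ⟨[], r, R, rfl, ?_⟩
      simp only [List.nil_append, List.pairwise_cons, List.mem_cons]
      refine ⟨?_, hR⟩
      rintro a (rfl | ha)
      exacts [h, h.trans (hR.1 a ha)]
    · rcases ih hR.2 hxR with h' | ⟨A, z, B, rfl, hp⟩
      · left
        rw [List.cons_append, List.pairwise_cons]
        refine ⟨fun a ha => ?_, h'⟩
        rcases List.mem_append.1 ha with ha | ha
        · exact hR.1 a ha
        · rw [List.mem_singleton.1 ha]
          exact h
      · refine .inr ⟨r :: A, z, B, rfl, ?_⟩
        rw [List.cons_append, List.pairwise_cons]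
        refine ⟨fun a ha => ?_, hp⟩
        simp only [List.mem_append, List.mem_cons] at ha
        rcases ha with ha | rfl | ha
        · exact hR.1 a (by simp [ha])
        · exact h
        · exact hR.1 a (by simp [ha])

lemma forall_sublist_bump_iff {A B rest : List ℕ} {x z m : ℕ}
    (hp : (A ++ x :: z :: B).Pairwise (· < ·)) :
    (∀ s : List ℕ, s.Sublist (A ++ z :: B ++ x :: rest) → s.Pairwise (· < ·) → s.length ≤ m) ↔
      ∀ s : List ℕ, s.Sublist (A ++ x :: B ++ rest) → s.Pairwise (· < ·) → s.length ≤ m := by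
  simp only [List.pairwise_append, List.pairwise_cons, List.mem_cons] at hp
  obtain ⟨-, ⟨hx, hz, -⟩, hA⟩ := hp
  have hxz : x < z := hx z (by simp)
  constructor
  · intro h s hs hsp
    obtain ⟨s', s₃, rfl, hs', h₃⟩ := List.sublist_append_iff.1 hs
    obtain ⟨s₁, s₂, rfl, h₁, h₂⟩ := List.sublist_append_iff.1 hs'
    rcases List.sublist_cons_iff.1 h₂ with h₂' | ⟨s₂, rfl, h₂'⟩
    · exact h _ ((h₁.append (h₂'.cons z)).append (h₃.cons x)) hsp
    · rcases eq_or_ne s₂ [] with rfl | hne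
      · have := h (s₁ ++ x :: s₃)
          (by simpa using h₁.append ((List.nil_sublist (z :: B)).append (h₃.cons_cons x)))
          (by simpa using hsp)
        simpa using this
      · obtain ⟨c, hc⟩ := List.exists_mem_of_ne_nil _ hne
        have := h (s₁ ++ z :: s₂ ++ s₃) ((h₁.append (h₂'.cons_cons z)).append (h₃.cons x)) (by
          simp only [List.pairwise_append, List.pairwise_cons, List.mem_append,
            List.mem_cons] at hsp ⊢
          have hz₂ : ∀ b ∈ s₂, z < b := fun b hb => hz b (h₂'.subset hb)
          have hz₃ : ∀ b ∈ s₃, z < b := fun b hb =>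
            (hz₂ c hc).trans (hsp.2.2 c (by simp [hc]) b hb)
          have hz₁ : ∀ a ∈ s₁, a < z := fun a ha => hA a (h₁.subset ha) z (by simp)
          clear h hA hx hz hs hs' h₁ h₂ h₂' h₃
          grind)
        simpa using this
  · intro h s hs hsp
    obtain ⟨s', s₃, rfl, hs', h₃⟩ := List.sublist_append_iff.1 hs
    obtain ⟨s₁, s₂, rfl, h₁, h₂⟩ := List.sublist_append_iff.1 hs'
    rcases List.sublist_cons_iff.1 h₃ with h₃' | ⟨s₃, rfl, h₃'⟩
    · rcases List.sublist_cons_iff.1 h₂ with h₂' | ⟨s₂, rfl, h₂'⟩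
      · exact h _ ((h₁.append (h₂'.cons x)).append h₃') hsp
      · have := h (s₁ ++ x :: s₂ ++ s₃) ((h₁.append (h₂'.cons_cons x)).append h₃') (by
          simp only [List.pairwise_append, List.pairwise_cons, List.mem_append,
            List.mem_cons] at hsp ⊢
          have hx₁ : ∀ a ∈ s₁, a < x := fun a ha => hA a (h₁.subset ha) x (by simp)
          clear h hA hx hz hs hs' h₁ h₂ h₂' h₃ h₃'
          grind)
        simpa using this
    · rcases eq_or_ne s₂ [] with rfl | hne
      · have := h (s₁ ++ x :: s₃)
          (by simpa using h₁.append (((List.nil_sublist B).cons_cons x).append h₃'))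
          (by simpa using hsp)
        simpa using this
      · obtain ⟨c, hc⟩ := List.exists_mem_of_ne_nil _ hne
        have h₁ := hx c (by simpa using h₂.subset hc)
        rw [List.pairwise_append] at hsp
        have h₂ := hsp.2.2 c (by simp [hc]) x (by simp)
        omega

lemma HasInsertableRow.of_succ {t m : ℕ} {l : List ℕ} (htm : t ≤ m)
    (h : HasInsertableRow t (m + 1) l) : HasInsertableRow t m l := by
  obtain ⟨y, R, rest, rfl, hy, hR, hI⟩ := h
  obtain rfl | ⟨R, x, rfl⟩ := R.eq_nil_or_concat'
  · simp at hR
  · have hm : R.length = m := by simpa using hR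
    refine ⟨y, R, x :: rest, by simp, hy, hm, ?_⟩
    simpa using hI.erase (S := R) (T := []) (e := x) rfl (by omega)

lemma invMajGF_hasInsertableRow {n t m : ℕ} (htm : t ≤ m) (hn : t + m < n) :
    invMajGF n (HasInsertableRow t m) =
      invMajGF n (HasInsertableRow t (m + 1)) + invMajGF n (HasInsertableRow (t + 1) m) := by
  rw [invMajGF_add (Q := HasInsertableRow t (m + 1))
    (R := fun l => HasInsertableRow t m l ∧ ¬ HasInsertableRow t (m + 1) l)]
  · congr 1
    refine invMajGF_eq_of_bump (t := t) (m := m) ?_ ?_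
    · rintro _ hl ⟨⟨y, R, rest, rfl, hy, hR, hI⟩, hnot⟩
      have hnd := hl.nodup_iff.2 List.nodup_range
      have hlen := hl.length_eq
      obtain _ | ⟨x, rest⟩ := rest
      · simp at hlen; omega
      have hx : x ∉ R := by
        rw [List.nodup_append] at hnd
        exact fun h => hnd.2.2 x (by simp [h]) x (by simp) rfl
      rcases pairwise_concat_or_exists_bump hI.pairwise hx with hp | ⟨A, z, B, rfl, hp⟩
      · refine absurd ⟨y, R ++ [x], rest, by simp, hy, by simp [hR], ?_⟩ hnot
        have hnd' : (y ++ (R ++ [x])).Nodup := hnd.sublist (by simp)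
        rw [List.nodup_append] at hnd'
        exact hI.insert (S := R) (T := []) (by simp) hp
          (fun a ha ha' => hnd'.2.2 a ha a ha' rfl) hnd'.1
      · exact ⟨_, ⟨y, A, z, B, x, rest, hy, by simp at hR; omega, hp, rfl, rfl⟩,
          y ++ [z], A ++ x :: B, rest, rfl, by simp [hy], by simp at hR ⊢; omega, hI.snoc hp⟩
    · rintro _ - ⟨y, R, rest, rfl, hy, hR, hI⟩
      obtain rfl | ⟨y, z, rfl⟩ := y.eq_nil_or_concat'
      · simp at hy
      obtain ⟨A, x, B, rfl, hI', hp⟩ := hI.exists_of_snoc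
      have hy' : y.length = t := by simpa using hy
      refine ⟨_, ⟨y, A, z, B, x, rest, hy', by simp at hR; omega, hp, rfl, rfl⟩,
        ⟨y, A ++ z :: B, x :: rest, by simp, hy', by simp at hR ⊢; omega, hI'⟩, ?_⟩
      rintro ⟨y', R', rest', hl, hy'', hR', hI''⟩
      rw [show y ++ (A ++ z :: B) ++ x :: rest = y ++ (A ++ z :: B ++ [x]) ++ rest by simp] at hl
      obtain ⟨hl', -⟩ := List.append_inj hl (by simp at hR ⊢; omega)
      obtain ⟨-, rfl⟩ := List.append_inj hl' (by omega)
      have h₁ := hI''.pairwise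
      simp only [List.pairwise_append, List.pairwise_cons, List.mem_cons] at h₁ hp
      have h₂ := h₁.2.2 z (by simp) x (by simp)
      have h₃ := hp.2.1.1 z (by simp)
      omega
  · intro l _
    have := @HasInsertableRow.of_succ t m l htm
    tauto
  · tauto

lemma invMajGF_hasLongestRow_succ {n t m : ℕ} (hn : t + m < n) :
    invMajGF n (HasLongestRow t m) = invMajGF n (HasLongestRow (t + 1) m) := by
  refine invMajGF_eq_of_bump (t := t) (m := m) ?_ ?_
  · rintro _ hl ⟨y, R, rest, rfl, hy, hR, hI, hs⟩
    have hnd := hl.nodup_iff.2 List.nodup_range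
    have hlen := hl.length_eq
    obtain _ | ⟨x, rest⟩ := rest
    · simp at hlen; omega
    have hx : x ∉ R := by
      rw [List.nodup_append] at hnd
      exact fun h => hnd.2.2 x (by simp [h]) x (by simp) rfl
    rcases pairwise_concat_or_exists_bump hI.pairwise hx with hp | ⟨A, z, B, rfl, hp⟩
    · have := hs _ (by simp) hp
      simp at this
      omega
    · exact ⟨_, ⟨y, A, z, B, x, rest, hy, by simp at hR; omega, hp, rfl, rfl⟩,
        y ++ [z], A ++ x :: B, rest, rfl, by simp [hy], by simp at hR ⊢; omega, hI.snoc hp,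
        (forall_sublist_bump_iff hp).1 hs⟩
  · rintro _ - ⟨y, R, rest, rfl, hy, hR, hI, hs⟩
    obtain rfl | ⟨y, z, rfl⟩ := y.eq_nil_or_concat'
    · simp at hy
    obtain ⟨A, x, B, rfl, hI', hp⟩ := hI.exists_of_snoc
    have hy' : y.length = t := by simpa using hy
    exact ⟨_, ⟨y, A, z, B, x, rest, hy', by simp at hR; omega, hp, rfl, rfl⟩,
      y, A ++ z :: B, x :: rest, by simp, hy', by simp at hR ⊢; omega, hI',
      (forall_sublist_bump_iff hp).2 hs⟩

lemma invMajGF_hasLongestRow {n m k : ℕ} (hn : k + m = n) :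
    invMajGF n (HasLongestRow 0 m) = invMajGF n (HasInsertableRow k m) := by
  have key : ∀ t ≤ k, invMajGF n (HasLongestRow 0 m) = invMajGF n (HasLongestRow t m) := by
    intro t
    induction t with
    | zero => simp
    | succ t ih =>
      intro ht
      rw [ih (by omega), invMajGF_hasLongestRow_succ (by omega)]
  rw [key k le_rfl]
  refine invMajGF_congr fun l hl => ⟨?_, ?_⟩
  · rintro ⟨y, R, rest, h, hy, hR, hI, -⟩
    exact ⟨y, R, rest, h, hy, hR, hI⟩
  · rintro ⟨y, R, rest, rfl, hy, hR, hI⟩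
    refine ⟨y, R, rest, rfl, hy, hR, hI, fun s hs _ => ?_⟩
    have h₁ := hl.length_eq
    have h₂ := hs.length_le
    simp at h₁ h₂
    omega

lemma invMajGF_hasInsertableRow_eq_fwdDiff {n k : ℕ} (hk : 2 * k ≤ n) (t : ℕ) :
    ∀ j, t + j ≤ k → invMajGF n (HasInsertableRow t (n - (t + j))) =
      (fwdDiff 1)^[t] (fun r => invMajGF n (HasInsertableRow 0 (n - r))) j := by
  induction t with
  | zero => simp
  | succ t ih =>
    intro j hj
    rw [Function.iterate_succ_apply', fwdDiff, ← ih j (by omega), ← ih (j + 1) (by omega),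
      eq_sub_iff_add_eq, show t + 1 + j = t + (j + 1) by omega,
      invMajGF_hasInsertableRow (t := t) (m := n - (t + (j + 1))) (by omega) (by omega), add_comm,
      show n - (t + (j + 1)) + 1 = n - (t + j) by omega]

lemma perm_range_iff {n : ℕ} {l : List ℕ} :
    l.Perm (List.range n) ↔ l.Nodup ∧ l.length = n ∧ ∀ v ∈ l, v < n := by
  constructor
  · intro h
    exact ⟨h.nodup_iff.2 List.nodup_range, by simpa using h.length_eq,
      fun v hv => by simpa using h.subset hv⟩
  · rintro ⟨hn, hl, hv⟩
    refine (List.subperm_of_subset hn fun v h => by simpa using hv v h).perm_of_length_le ?_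
    simp [hl]

/-- The order embedding of `ℕ` into itself whose range misses exactly `j`. -/
def skip (j v : ℕ) : ℕ := if v < j then v else v + 1

lemma skip_injective (j : ℕ) : Function.Injective (skip j) := by
  intro a b h
  simp only [skip] at h
  split_ifs at h <;> omega

lemma skip_ne (j v : ℕ) : skip j v ≠ j := by
  unfold skip
  split_ifs <;> omega

lemma skip_lt_skip {j a b : ℕ} : skip j a < skip j b ↔ a < b := by
  unfold skip
  split_ifs <;> omega

lemma skip_pred {j v : ℕ} (h : v ≠ j) : skip j (if v < j then v else v - 1) = v := by
  unfold skip
  split_ifs <;> omega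

/-- Make room for the letter `j` in the word `l` and append it. -/
def appendLetter (j : ℕ) (l : List ℕ) : List ℕ := l.map (skip j) ++ [j]

lemma idxOf_appendLetter_self (j : ℕ) (l : List ℕ) : (appendLetter j l).idxOf j = l.length := by
  have : j ∉ l.map (skip j) := by
    simpa using fun v _ => skip_ne j v
  simp [appendLetter, List.idxOf_append, this]

lemma idxOf_appendLetter_skip (j : ℕ) {l : List ℕ} {v : ℕ} (hv : v ∈ l) :
    (appendLetter j l).idxOf (skip j v) = l.idxOf v := by
  rw [appendLetter, List.idxOf_append_of_mem (List.mem_map_of_mem hv)]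
  clear hv
  induction l with
  | nil => rfl
  | cons a l ih => simp [List.idxOf_cons, ih, (skip_injective j).beq_eq]

/-- The major index obtained by inserting a largest letter at position `j` in a permutation of
size `n` whose set of descents is `D`, positions being counted from `0`. -/
def insertMaj (D : ℕ → Prop) [DecidablePred D] (n j : ℕ) : ℕ :=
  ∑ i ∈ Finset.range n,
    if i + 1 < j then (if D i then i + 1 else 0)
    else if i + 1 = j then 0
    else if i = j then i + 1
    else if D (i - 1) then i + 1 else 0

lemma invMaj_appendLetter {n j : ℕ} {l : List ℕ} (hl : l.Perm (List.range n)) (hj : j ≤ n) :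
    invMaj (n + 1) (appendLetter j l) =
      insertMaj (fun i => l.idxOf (i + 1) < l.idxOf i) n j := by
  have hmem : ∀ v, v < n → v ∈ l := fun v hv => hl.mem_iff.2 (by simpa)
  have hlt : ∀ v, v < n → l.idxOf v < l.length := fun v hv =>
    List.idxOf_lt_length_of_mem (hmem v hv)
  unfold invMaj insertMaj
  refine Finset.sum_congr rfl fun i hi => ?_
  have hi : i < n := by simpa using hi
  have hskip : ∀ v, v < n → (appendLetter j l).idxOf (skip j v) = l.idxOf v := fun v hv =>
    idxOf_appendLetter_skip j (hmem v hv)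
  have hself := idxOf_appendLetter_self j l
  have hlow : ∀ v, v < j → skip j v = v := fun v hv => if_pos hv
  have hhigh : ∀ v, j ≤ v → skip j v = v + 1 := fun v hv => if_neg (by omega)
  obtain h | h | h | h : i + 1 < j ∨ i + 1 = j ∨ i = j ∨ j < i := by omega
  · have h₁ := hskip i hi
    have h₂ := hskip (i + 1) (by omega)
    rw [hlow _ (by omega)] at h₁ h₂
    rw [h₁, h₂, if_pos h]
  · have h₁ := hskip i hi
    have h₂ := hlt i hi
    rw [hlow _ (by omega)] at h₁
    rw [h, h₁, hself, if_neg (by omega), if_neg (by omega), if_pos rfl]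
  · subst h
    have h₁ := hskip i hi
    have h₂ := hlt i hi
    rw [hhigh _ le_rfl] at h₁
    rw [h₁, hself, if_pos (by omega), if_neg (by omega), if_neg (by omega), if_pos rfl]
  · obtain ⟨i, rfl⟩ : ∃ i', i = i' + 1 := ⟨i - 1, by omega⟩
    have h₁ := hskip i (by omega)
    have h₂ := hskip (i + 1) hi
    rw [hhigh _ (by omega)] at h₁ h₂
    rw [h₁, h₂, if_neg (by omega : ¬i + 1 + 1 < j), if_neg (by omega : ¬i + 1 + 1 = j),
      if_neg (by omega : ¬i + 1 = j), Nat.add_sub_cancel]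

lemma insertMaj_self (D : ℕ → Prop) [DecidablePred D] (n : ℕ) :
    insertMaj D n n = ∑ i ∈ Finset.range (n - 1), if D i then i + 1 else 0 := by
  cases n with
  | zero => rfl
  | succ n =>
    rw [insertMaj, Finset.sum_range_succ]
    simp only [lt_self_iff_false, if_true, if_false, add_zero, Nat.add_sub_cancel]
    refine Finset.sum_congr rfl fun i hi => ?_
    rw [if_pos (by simpa using hi)]

lemma sum_X_pow_insertMaj_lt (D : ℕ → Prop) [DecidablePred D] (n : ℕ) :
    ∑ j ∈ Finset.range n, (X : Polynomial ℤ) ^ insertMaj D n j =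
      X ^ ((∑ i ∈ Finset.range (n - 1), if D i then i + 1 else 0) + 1) * qInt n := by
  induction n with
  | zero => simp [qInt]
  | succ n ih =>
    obtain _ | n := n
    · simp [insertMaj, qInt]
    have h₁ : ∀ j ∈ Finset.range (n + 1), (X : Polynomial ℤ) ^ insertMaj D (n + 2) j =
        X ^ insertMaj D (n + 1) j * X ^ (if D n then n + 2 else 0) := by
      intro j hj
      have hj : j < n + 1 := by simpa using hj
      rw [insertMaj, Finset.sum_range_succ, ← insertMaj, pow_add, if_neg (by omega),
        if_neg (by omega), if_neg (by omega)]
      rfl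
    have h₂ : insertMaj D (n + 2) (n + 1) = insertMaj D (n + 1) (n + 1) + (n + 2) := by
      rw [insertMaj, Finset.sum_range_succ, ← insertMaj]
      simp
    rw [Finset.sum_range_succ, Finset.sum_congr rfl h₁, ← Finset.sum_mul, ih, h₂, insertMaj_self]
    simp only [Nat.add_sub_cancel, Finset.sum_range_succ _ n]
    generalize (∑ i ∈ Finset.range n, if D i then i + 1 else 0) = S
    split_ifs
    · have : qInt (n + 1 + 1) = X * qInt (n + 1) + 1 := by
        rw [qInt, Finset.sum_range_succ', qInt, Finset.mul_sum]
        simp [pow_succ']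
      rw [this]
      ring
    · have : qInt (n + 1 + 1) = qInt (n + 1) + X ^ (n + 1) := by
        rw [qInt, Finset.sum_range_succ, qInt]
      rw [this]
      ring

lemma sum_X_pow_insertMaj (D : ℕ → Prop) [DecidablePred D] (n : ℕ) :
    ∑ j ∈ Finset.range (n + 1), (X : Polynomial ℤ) ^ insertMaj D n j =
      qInt (n + 1) * X ^ (∑ i ∈ Finset.range (n - 1), if D i then i + 1 else 0) := by
  have : qInt (n + 1) = X * qInt n + 1 := by
    rw [qInt, Finset.sum_range_succ', qInt, Finset.mul_sum]
    simp [pow_succ']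
  rw [Finset.sum_range_succ, sum_X_pow_insertMaj_lt, insertMaj_self, this]
  ring

lemma invMajGF_take_succ {n m : ℕ} (hm : m ≤ n) :
    invMajGF (n + 1) (fun l => (l.take m).Pairwise (· < ·)) =
      qInt (n + 1) * invMajGF n (fun l => (l.take m).Pairwise (· < ·)) := by
  rw [invMajGF_eq_sum_filter, invMajGF_eq_sum_filter, Finset.mul_sum]
  have h : ∀ l ∈ (permWords n).filter fun l => (l.take m).Pairwise (· < ·),
      qInt (n + 1) * X ^ invMaj n l =
        ∑ j ∈ Finset.range (n + 1), X ^ invMaj (n + 1) (appendLetter j l) := by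
    intro l hl
    rw [Finset.mem_filter, mem_permWords] at hl
    rw [invMaj, ← sum_X_pow_insertMaj fun i => l.idxOf (i + 1) < l.idxOf i]
    refine Finset.sum_congr rfl fun j hj => ?_
    rw [invMaj_appendLetter hl.1 (by simpa [Nat.lt_succ_iff] using hj)]
  rw [Finset.sum_congr rfl h, ← Finset.sum_product']
  symm
  refine Finset.sum_nbij (fun p => appendLetter p.2 p.1) ?_ ?_ ?_ fun _ _ => rfl
  · rintro ⟨l, j⟩ hlj
    simp only [Finset.mem_product, Finset.mem_filter, mem_permWords, Finset.mem_range,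
      perm_range_iff] at hlj ⊢
    obtain ⟨⟨⟨hn, hl, hv⟩, hp⟩, hj⟩ := hlj
    refine ⟨⟨?_, by simp [appendLetter, hl], ?_⟩, ?_⟩
    · rw [appendLetter, List.nodup_append]
      refine ⟨hn.map (skip_injective j), by simp, ?_⟩
      simp only [List.mem_map, List.mem_singleton]
      rintro _ ⟨v, -, rfl⟩ _ rfl
      exact skip_ne _ v
    · simp only [appendLetter, List.mem_append, List.mem_map, List.mem_singleton]
      rintro _ (⟨v, hvl, rfl⟩ | rfl)
      · have := hv v hvl
        unfold skip
        split_ifs <;> omega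
      · exact hj
    · rw [appendLetter, List.take_append_of_le_length (by simp; omega), ← List.map_take,
        List.pairwise_map]
      simpa only [skip_lt_skip] using hp
  · rintro ⟨l, j⟩ - ⟨l', j'⟩ - h
    obtain ⟨h₁, h₂⟩ := List.append_inj' h rfl
    obtain rfl : j = j' := by simpa using h₂
    exact congrArg (·, j) (List.map_injective_iff.2 (skip_injective j) h₁)
  · intro l hl
    simp only [Finset.coe_filter, Set.mem_ofPred_eq, mem_permWords, perm_range_iff] at hl
    obtain ⟨⟨hn, hlen, hv⟩, hp⟩ := hl
    obtain rfl | ⟨l, j, rfl⟩ := l.eq_nil_or_concat'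
    · simp at hlen
    have hlen' : l.length = n := by simpa using hlen
    rw [List.nodup_append] at hn
    have hjl : ∀ v ∈ l, v ≠ j := fun v hvl => hn.2.2 v hvl j (by simp)
    set l' := l.map fun v => if v < j then v else v - 1 with hl'
    have hmap : l'.map (skip j) = l := by
      rw [hl', List.map_map]
      exact (List.map_congr_left fun v hvl => skip_pred (hjl v hvl)).trans (List.map_id l)
    refine ⟨⟨l', j⟩, ?_, by simp [appendLetter, hmap]⟩
    have hj : j < n + 1 := hv j (by simp)
    simp only [Finset.coe_product, Set.mem_prod, Finset.coe_filter, Set.mem_ofPred_eq,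
      mem_permWords, perm_range_iff, Finset.coe_range, Set.mem_Iio]
    refine ⟨⟨⟨?_, by simp [hl', hlen'], ?_⟩, ?_⟩, hj⟩
    · exact List.Nodup.of_map (skip j) (by rw [hmap]; exact hn.1)
    · simp only [hl', List.mem_map]
      rintro _ ⟨v, hvl, rfl⟩
      have h₁ := hjl v hvl
      have h₂ := hv v (by simp [hvl])
      split_ifs <;> omega
    · rw [List.take_append_of_le_length (by omega), ← hmap, ← List.map_take,
        List.pairwise_map] at hp
      simpa only [skip_lt_skip] using hp

lemma invMajGF_take_self (n : ℕ) :
    invMajGF n (fun l => (l.take n).Pairwise (· < ·)) = 1 := by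
  have h : (permWords n).filter (fun l => (l.take n).Pairwise (· < ·)) = {List.range n} := by
    ext l
    rw [Finset.mem_filter, mem_permWords, Finset.mem_singleton]
    constructor
    · rintro ⟨h₁, h₂⟩
      rw [List.take_of_length_le (by simpa using h₁.length_eq.le)] at h₂
      exact h₁.eq_of_pairwise' h₂ List.pairwise_lt_range
    · rintro rfl
      exact ⟨.refl _, List.pairwise_lt_range.take⟩
  have h' : invMaj n (List.range n) = 0 := by
    refine Finset.sum_eq_zero fun i hi => if_neg ?_
    have hi : i < n - 1 := by simpa using hi
    have key : ∀ v < n, (List.range n).idxOf v = v := fun v hv => by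
      have := List.nodup_range (n := n) |>.idxOf_getElem v (by simpa)
      simpa using this
    rw [key _ (by omega), key _ (by omega)]
    omega
  rw [invMajGF_eq_sum_filter, h, Finset.sum_singleton, h', pow_zero]

lemma invMajGF_take {n r : ℕ} (hr : r ≤ n) :
    invMajGF n (fun l => (l.take (n - r)).Pairwise (· < ·)) =
      ∏ j ∈ Finset.range r, qInt (n - j) := by
  induction r generalizing n with
  | zero => simp [invMajGF_take_self]
  | succ r ih =>
    obtain _ | n := n
    · omega
    rw [show n + 1 - (r + 1) = n - r by omega, invMajGF_take_succ (by omega), ih (by omega),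
      Finset.prod_range_succ']
    simp [mul_comm]

lemma hasInsertableRow_zero_iff {m : ℕ} {l : List ℕ} (hm : m ≤ l.length) :
    HasInsertableRow 0 m l ↔ (l.take m).Pairwise (· < ·) := by
  constructor
  · rintro ⟨y, R, rest, rfl, hy, rfl, hI⟩
    obtain rfl : y = [] := by simpa using hy
    simpa using hI.pairwise
  · intro h
    exact ⟨[], l.take m, l.drop m, by simp, rfl, by simpa, .nil h⟩

lemma hasLongestRow_zero_iff {m : ℕ} {l : List ℕ} (hm : m ≤ l.length) :
    HasLongestRow 0 m l ↔ (l.take m).Pairwise (· < ·) ∧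
      ∀ s : List ℕ, s.Sublist l → s.Pairwise (· < ·) → s.length ≤ m := by
  constructor
  · rintro ⟨y, R, rest, rfl, hy, rfl, hI, hs⟩
    obtain rfl : y = [] := by simpa using hy
    exact ⟨by simpa using hI.pairwise, hs⟩
  · rintro ⟨h, hs⟩
    exact ⟨[], l.take m, l.drop m, by simp, rfl, by simpa, .nil h, by simpa using hs⟩

/-- The one-line notation of a permutation. -/
def permWord {n : ℕ} (w : Equiv.Perm (Fin n)) : List ℕ := List.ofFn fun i => (w i : ℕ)

lemma length_permWord {n : ℕ} (w : Equiv.Perm (Fin n)) : (permWord w).length = n := by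
  simp [permWord]

lemma permWord_injective {n : ℕ} : Function.Injective (permWord (n := n)) := by
  intro w w' h
  ext i
  exact congrFun (List.ofFn_injective h) i

lemma permWord_perm {n : ℕ} (w : Equiv.Perm (Fin n)) : (permWord w).Perm (List.range n) := by
  rw [perm_range_iff]
  refine ⟨List.nodup_ofFn.2 (Fin.val_injective.comp w.injective), length_permWord w, ?_⟩
  simp [permWord, List.mem_ofFn]

lemma exists_permWord_eq {n : ℕ} {l : List ℕ} (h : l.Perm (List.range n)) :
    ∃ w : Equiv.Perm (Fin n), permWord w = l := by
  obtain ⟨hn, rfl, hv⟩ := perm_range_iff.1 h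
  have hinj : Function.Injective
      fun i : Fin l.length => (⟨l[i], hv _ (by simp)⟩ : Fin l.length) := by
    intro i j hij
    simpa [hn.getElem_inj_iff, Fin.ext_iff] using hij
  refine ⟨Equiv.ofBijective _ (Finite.injective_iff_bijective.1 hinj), ?_⟩
  simp [permWord]

lemma idxOf_permWord {n : ℕ} (w : Equiv.Perm (Fin n)) {i : ℕ} (hi : i < n) :
    (permWord w).idxOf i = w⁻¹ ⟨i, hi⟩ := by
  have h := (permWord_perm w).nodup_iff.2 List.nodup_range
  have := h.idxOf_getElem (w⁻¹ ⟨i, hi⟩) (by simp [permWord])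
  simpa [permWord] using this

lemma maj_inv_eq {n : ℕ} (w : Equiv.Perm (Fin n)) : maj w⁻¹ = invMaj n (permWord w) := by
  obtain _ | n := n
  · rfl
  unfold maj invMaj
  rw [Finset.sum_range_succ, dif_neg (by omega), add_zero]
  refine Finset.sum_congr rfl fun i hi => ?_
  have hi : i < n := by simpa using hi
  rw [dif_pos (by omega), idxOf_permWord w (by omega), idxOf_permWord w (by omega)]
  rfl

lemma prefixInc_iff {n k : ℕ} (w : Equiv.Perm (Fin n)) :
    PrefixInc n k w ↔ ((permWord w).take (n - k)).Pairwise (· < ·) := by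
  rw [List.pairwise_iff_getElem]
  simp only [permWord, List.length_take, List.length_ofFn, lt_min_iff, List.getElem_take,
    List.getElem_ofFn, Fin.val_fin_lt, PrefixInc]
  constructor
  · intro h i j hi hj hij
    exact h _ _ hij hj.1
  · intro h i j hij hj
    exact h i j ⟨by omega, i.2⟩ ⟨hj, j.2⟩ hij

lemma hasIncSubseq_iff {n m : ℕ} (w : Equiv.Perm (Fin n)) :
    HasIncSubseq w m ↔
      ∃ s : List ℕ, s.Sublist (permWord w) ∧ s.Pairwise (· < ·) ∧ s.length = m := by
  constructor
  · rintro ⟨f, hf, hwf⟩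
    refine ⟨List.ofFn fun j => (w (f j) : ℕ), ?_, ?_, by simp⟩
    · rw [List.sublist_iff_exists_fin_orderEmbedding_get_eq]
      refine ⟨(Fin.castOrderIso (by simp)).toOrderEmbedding.trans
        ((OrderEmbedding.ofStrictMono f hf).trans
          (Fin.castOrderIso (length_permWord w).symm).toOrderEmbedding), fun i => ?_⟩
      simp only [permWord, List.get_ofFn]
      rfl
    · rw [List.pairwise_ofFn]
      exact fun i j hij => hwf hij
  · rintro ⟨s, hs, hp, rfl⟩
    obtain ⟨f, hf⟩ := List.sublist_iff_exists_fin_orderEmbedding_get_eq.1 hs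
    refine ⟨fun j => Fin.cast (length_permWord w) (f j), fun i j hij => by simpa using hij,
      fun i j hij => ?_⟩
    have key : ∀ j, (w (Fin.cast (length_permWord w) (f j)) : ℕ) = s.get j := fun j => by
      rw [hf j]
      simp only [permWord, List.get_ofFn]
    rw [Fin.lt_def, key, key]
    exact List.pairwise_iff_get.1 hp i j hij

lemma mem_PiFinset_iff {n k : ℕ} (w : Equiv.Perm (Fin n)) :
    w ∈ PiFinset n k ↔ HasLongestRow 0 (n - k) (permWord w) := by
  classical
  rw [hasLongestRow_zero_iff (by simp [length_permWord]), ← prefixInc_iff, PiFinset,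
    @Finset.mem_filter _ _ (Classical.decPred _)]
  simp only [Finset.mem_univ, true_and]
  refine and_congr_right fun hw => ?_
  have hmem : HasIncSubseq w (n - k) := (hasIncSubseq_iff w).2
    ⟨_, List.take_sublist _ _, (prefixInc_iff w).1 hw, by simp [length_permWord]⟩
  have hbdd : BddAbove {m | HasIncSubseq w m} := by
    refine ⟨n, ?_⟩
    rintro m ⟨f, hf, -⟩
    simpa using Fintype.card_le_of_injective f hf.injective
  constructor
  · intro h s hs hp
    rw [← h]
    exact le_csSup hbdd ((hasIncSubseq_iff w).2 ⟨s, hs, hp, rfl⟩)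
  · intro h
    refine le_antisymm (csSup_le ⟨_, hmem⟩ fun m hm => ?_) (le_csSup hbdd hmem)
    obtain ⟨s, hs, hp, rfl⟩ := (hasIncSubseq_iff w).1 hm
    exact h s hs hp

lemma sum_PiFinset_eq (n k : ℕ) :
    ∑ w ∈ PiFinset n k, (X : Polynomial ℤ) ^ maj w⁻¹ = invMajGF n (HasLongestRow 0 (n - k)) := by
  classical
  unfold invMajGF
  refine Finset.sum_nbij permWord ?_ permWord_injective.injOn ?_ fun w _ => by rw [maj_inv_eq]
  · intro w hw
    rw [Finset.mem_filter, mem_permWords]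
    exact ⟨permWord_perm w, (mem_PiFinset_iff w).1 hw⟩
  · intro l hl
    rw [Finset.mem_coe, Finset.mem_filter, mem_permWords] at hl
    obtain ⟨w, rfl⟩ := exists_permWord_eq hl.1
    exact ⟨w, (mem_PiFinset_iff w).2 hl.2, rfl⟩

/-- q-analogue of the Garsia--Goupil formula: for `n >= 2k`,
the sum over `Pi_{n,k}` of `q^{maj(w⁻¹)}` equals the alternating sum of
`C(k,r)` times the `r`-fold products of q-integers `[n]_q ⋯ [n-r+1]_q`. -/
theorem garsia_goupil_q (n k : ℕ) (h : 2 * k ≤ n) :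
    ∑ w ∈ PiFinset n k, (X : Polynomial ℤ) ^ maj w⁻¹ =
      ∑ r ∈ Finset.range (k + 1),
        (-1) ^ (k - r) * (k.choose r : Polynomial ℤ) *
          ∏ j ∈ Finset.range r, qInt (n - j) := by
  have hc : ∀ r ≤ k, invMajGF n (HasInsertableRow 0 (n - r)) =
      ∏ j ∈ Finset.range r, qInt (n - j) := by
    intro r hr
    rw [← invMajGF_take (by omega)]
    refine invMajGF_congr fun l hl => hasInsertableRow_zero_iff ?_
    rw [hl.length_eq, List.length_range]
    omega
  have hd := invMajGF_hasInsertableRow_eq_fwdDiff h k 0 le_rfl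
  rw [add_zero, fwdDiff_iter_eq_sum_shift] at hd
  rw [sum_PiFinset_eq, invMajGF_hasLongestRow (k := k) (by omega), hd]
  refine Finset.sum_congr rfl fun r hr => ?_
  rw [zero_add, smul_eq_mul, mul_one, hc r (by simpa [Nat.lt_succ_iff] using hr), zsmul_eq_mul]
  push_cast
  ring
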